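/- arXiv:1408.5546 — 3 statements merged into one kernel-verified Lean document; each statement's English description precedes it below -/
import Mathlib

section
/- Let A be a simple C*-algebra, let B ⊂ A be a nonzero hereditary subalgebra, let n be a positive integer, and let a₁, …, aₙ ∈ A₊ be nonzero. Then there exists a nonzero b ∈ B₊ such that b ≾_A aⱼ for j = 1, …, n. -/
open Filter Topology

/-- Cuntz subequivalence: `a ≾ b` iff there is a sequence `vₙ` with `vₙ b vₙ* → a`. -/
def CuntzSubequiv (A : Type*) [Mul A] [Star A] [TopologicalSpace A] (a b : A) : Prop :=
  ∃ v : ℕ → A, Tendsto (fun n => v n * b * star (v n)) atTop (𝓝 a)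

section aux
variable {A : Type*} [NonUnitalCStarAlgebra A]

lemma aux_sq_ne {c : A} (hc : star c = c) (h : c ≠ 0) : c * c ≠ 0 := by
  intro h0
  apply h
  have : star c * c = 0 := by rw [hc]; exact h0
  exact CStarRing.star_mul_self_eq_zero_iff c |>.1 this

lemma aux_prime (hsimple : ∀ I : TwoSidedIdeal A, IsClosed (I : Set A) → I = ⊥ ∨ I = ⊤)
    {b a : A} (hb : star b = b) (hb0 : b ≠ 0) (ha0 : a ≠ 0) : ∃ x, b * x * a ≠ 0 := by
  by_contra! h
  let I : TwoSidedIdeal A := TwoSidedIdeal.mk' {z | ∀ x, b * x * z = 0}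
    (by intro x; simp)
    (by intro y z hy hz x; rw [mul_add, hy x, hz x, add_zero])
    (by intro y hy x; rw [mul_neg, hy x, neg_zero])
    (by intro r y hy x; rw [← mul_assoc, mul_assoc b, hy (x * r)])
    (by intro y r hy x; rw [← mul_assoc, hy x, zero_mul])
  have hI : ∀ z, z ∈ I ↔ ∀ x, b * x * z = 0 := fun z => by
    simp [I, TwoSidedIdeal.mem_mk']
  have hcl : IsClosed (I : Set A) := by
    have : (I : Set A) = ⋂ x, {z | b * x * z = 0} := by
      ext z; simp [hI]
    rw [this]
    exact isClosed_iInter fun x => isClosed_eq (by fun_prop) continuous_const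
  rcases hsimple I hcl with h1 | h1
  · have : a ∈ I := (hI a).2 h
    rw [h1] at this
    exact ha0 this
  · have : b * b ∈ I := by rw [h1]; trivial
    have h2 := (hI _).1 this b
    exact aux_sq_ne (c := b * b) (by simp [hb]) (aux_sq_ne hb hb0) h2

lemma aux_step [PartialOrder A] [StarOrderedRing A]
    (hsimple : ∀ I : TwoSidedIdeal A, IsClosed (I : Set A) → I = ⊥ ∨ I = ⊤)
    (B : NonUnitalStarSubalgebra ℂ A)
    (hBher : ∀ x y : A, 0 ≤ x → x ≤ y → y ∈ B → x ∈ B)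
    {b a : A} (hbB : b ∈ B) (hb : 0 ≤ b) (hb0 : b ≠ 0) (ha : 0 ≤ a) (ha0 : a ≠ 0) :
    ∃ d ∈ B, 0 ≤ d ∧ d ≠ 0 ∧ (∃ w, d = w * a * star w) ∧ ∃ w, d = w * b * star w := by
  have sb : star b = b := (IsSelfAdjoint.of_nonneg hb).star_eq
  obtain ⟨x, hx⟩ := aux_prime hsimple sb hb0 ha0
  have key : ∀ p : A, 0 ≤ p → ∃ q, star q = q ∧ q * q = p := fun p hp =>
    ⟨CFC.sqrt p, (IsSelfAdjoint.of_nonneg (CFC.sqrt_nonneg p)).star_eq,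
      CFC.sqrt_mul_sqrt_self p hp⟩
  obtain ⟨s, ss, hs⟩ := key a ha
  obtain ⟨t, st, ht⟩ := key b hb
  have sy : star (x * a * star x) = x * a * star x := by
    simp [(IsSelfAdjoint.of_nonneg ha).star_eq, mul_assoc]
  obtain ⟨y, hy⟩ : ∃ y, y = x * a * star x := ⟨_, rfl⟩
  rw [← hy] at sy
  have hc1 : b * y * b = (b * x * s) * star (b * x * s) := by
    simp [hy, ← hs, ss, sb, mul_assoc]
  have hc : 0 ≤ b * y * b := hc1 ▸ mul_star_self_nonneg _
  have hc0 : b * y * b ≠ 0 := by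
    rw [hc1]
    intro h
    have := (CStarRing.mul_star_self_eq_zero_iff _).1 h
    apply hx
    rw [← hs, ← mul_assoc, this, zero_mul]
  have sc := (IsSelfAdjoint.of_nonneg hc).star_eq
  have hcB : b * y * b ∈ B := by
    refine hBher _ (‖y‖ • (b * b)) hc ?_ ?_
    · have := CStarAlgebra.star_left_conjugate_le_norm_smul (a := b) (b := y) (hb := sy)
      rwa [sb] at this
    · have := SMulMemClass.smul_mem (‖y‖ : ℂ) (mul_mem hbB hbB)
      simpa using this
  obtain ⟨r, sr, hr⟩ := key _ hc
  refine ⟨(b * y * b) * (b * y * b), mul_mem hcB hcB, ?_, aux_sq_ne sc hc0,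
    ⟨r * b * x, ?_⟩, ⟨b * y * t, ?_⟩⟩
  · nth_rw 1 [← sc]; exact star_mul_self_nonneg _
  · have : (b * y * b) * (b * y * b) = r * (b * y * b) * r := by
      rw [← hr]; simp only [mul_assoc]
    rw [this, hy]; simp [sr, sb, mul_assoc]
  · have : b * b = t * b * t := by rw [← ht]; simp only [mul_assoc]
    calc _ = b * y * (b * b) * y * b := by simp only [mul_assoc]
      _ = _ := by rw [this]; simp [st, sy, sb, mul_assoc]

end aux

/-- Lemma 2.4: in a simple C*-algebra `A`, given a nonzero hereditary subalgebra `B`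
and nonzero positive elements `a₁, …, aₙ`, there is a nonzero positive `b ∈ B` with
`b ≾_A aⱼ` for all `j`. -/
theorem exists_pos_mem_hereditary_subequiv {A : Type*} [NonUnitalCStarAlgebra A]
    [PartialOrder A] [StarOrderedRing A]
    (hsimple : ∀ I : TwoSidedIdeal A, IsClosed (I : Set A) → I = ⊥ ∨ I = ⊤)
    (B : NonUnitalStarSubalgebra ℂ A) (hBclosed : IsClosed (B : Set A))
    (hBher : ∀ x y : A, 0 ≤ x → x ≤ y → y ∈ B → x ∈ B) (hB0 : B ≠ ⊥)
    (n : ℕ) (a : Fin n → A) (hapos : ∀ j, 0 ≤ a j) (hane : ∀ j, a j ≠ 0) :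
    ∃ b : A, b ∈ B ∧ 0 ≤ b ∧ b ≠ 0 ∧ ∀ j, CuntzSubequiv A b (a j) := by
  suffices h : ∃ b : A, b ∈ B ∧ 0 ≤ b ∧ b ≠ 0 ∧ ∀ j, ∃ w, b = w * a j * star w by
    obtain ⟨b, h1, h2, h3, h4⟩ := h
    refine ⟨b, h1, h2, h3, fun j => ?_⟩
    obtain ⟨w, hw⟩ := h4 j
    exact ⟨fun _ => w, by rw [hw]; exact tendsto_const_nhds⟩
  induction n with
  | zero =>
    obtain ⟨x, hx, hx0⟩ : ∃ x ∈ B, x ≠ 0 := by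
      by_contra! h
      apply hB0
      rw [eq_bot_iff]
      intro x hx
      rw [h x hx]
      exact zero_mem _
    exact ⟨star x * x, mul_mem (star_mem hx) hx, star_mul_self_nonneg x,
      fun h => hx0 ((CStarRing.star_mul_self_eq_zero_iff x).1 h), fun j => j.elim0⟩
  | succ n ih =>
    obtain ⟨b, h1, h2, h3, h4⟩ := ih (fun j => a j.succ) (fun j => hapos _) (fun j => hane _)
    obtain ⟨d, hdB, hd, hd0, hda, u, hu⟩ :=
      aux_step hsimple B hBher h1 h2 h3 (hapos 0) (hane 0)
    refine ⟨d, hdB, hd, hd0, fun j => ?_⟩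
    refine Fin.cases hda (fun i => ?_) j
    obtain ⟨w, hw⟩ := h4 i
    refine ⟨u * w, ?_⟩
    rw [hu, hw]
    simp [mul_assoc]
end

section
/- Let A be a unital C*-algebra which is not of type I, and let n be a positive integer. Then there exist a unitary u ∈ A homotopic to 1 in the unitary group of A, and a nonzero positive element a ∈ A, such that the elements a, u a u⁻¹, u² a u⁻², …, uⁿ a u⁻ⁿ are pairwise orthogonal (pairwise products are zero). -/
/-- A (unital) representation `π : A → B(H)` is irreducible if the only closed invariant
subspaces are `⊥` and `⊤`. -/
def IsIrreducibleRep {A H : Type} [CStarAlgebra A] [NormedAddCommGroup H]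
    [InnerProductSpace ℂ H] [CompleteSpace H] (π : A →⋆ₐ[ℂ] (H →L[ℂ] H)) : Prop :=
  ∀ S : Submodule ℂ H, IsClosed (S : Set H) →
    (∀ (a : A) (v : H), v ∈ S → π a v ∈ S) → S = ⊥ ∨ S = ⊤

/-- A unital C*-algebra is of type I (GCR) if every irreducible representation contains
the compact operators in its range. -/
def IsTypeI (A : Type) [CStarAlgebra A] : Prop :=
  ∀ (H : Type) [NormedAddCommGroup H] [InnerProductSpace ℂ H] [CompleteSpace H]
    (π : A →⋆ₐ[ℂ] (H →L[ℂ] H)), IsIrreducibleRep π →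
    ∀ K : H →L[ℂ] H, IsCompactOperator K → K ∈ Set.range π

open scoped CStarAlgebra

namespace OrthConj

section General

variable {A B : Type} [CStarAlgebra A] [CStarAlgebra B]

lemma map_cfc_real (π : A →⋆ₐ[ℂ] B) (f : ℝ → ℝ) (hf : Continuous f) {a : A}
    (ha : IsSelfAdjoint a) : π (cfc f a) = cfc f (π a) := by
  have hc : Continuous π := map_continuous π
  exact StarAlgHomClass.map_cfc (S := ℂ) π f a (hf := hf.continuousOn) (hφ := hc) (ha := ha)
    (hφa := ha.map π)

lemma exists_lift_norm_le (π : A →⋆ₐ[ℂ] B) (a : A) : ∃ a' : A, π a' = π a ∧ ‖a'‖ ≤ ‖π a‖ := by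
  by_cases h0 : π a = 0
  · exact ⟨0, by simp [h0]⟩
  set r := ‖π a‖ with hr
  have hrpos : 0 < r := by rw [hr]; exact norm_pos_iff.mpr h0
  let f : ℝ → ℝ := fun t => r / max r (Real.sqrt |t|)
  have hmax : ∀ t : ℝ, 0 < max r (Real.sqrt |t|) := fun t => lt_max_of_lt_left hrpos
  have hf : Continuous f := by
    refine Continuous.div continuous_const (by fun_prop) (fun t => (hmax t).ne')
  have hsa : IsSelfAdjoint (star a * a) := IsSelfAdjoint.star_mul_self a
  have hfs : star (cfc f (star a * a)) = cfc f (star a * a) := (cfc_predicate f (star a * a) : IsSelfAdjoint _)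
  refine ⟨a * cfc f (star a * a), ?_, ?_⟩
  · have h1 : cfc f (π (star a * a)) = 1 := by
      rw [← cfc_const_one ℝ (π (star a * a)) (ha := hsa.map π)]
      apply cfc_congr
      intro t ht
      have h2 : ‖t‖ ≤ ‖π (star a * a)‖ * ‖(1 : B)‖ := spectrum.norm_le_norm_mul_of_mem ht
      have h3 : ‖π (star a * a)‖ = r * r := by
        rw [map_mul, map_star, CStarRing.norm_star_mul_self]
      have : Nontrivial B := ⟨_, _, h0⟩
      rw [h3, CStarRing.norm_one, mul_one, Real.norm_eq_abs] at h2
      have h4 : Real.sqrt |t| ≤ r := by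
        rw [← Real.sqrt_mul_self hrpos.le]; exact Real.sqrt_le_sqrt h2
      simp only [f]
      rw [max_eq_left h4, div_self hrpos.ne']
    rw [map_mul, map_cfc_real π f hf hsa, h1, mul_one]
  · have h1 : ‖a * cfc f (star a * a)‖ * ‖a * cfc f (star a * a)‖ ≤ r * r := by
      rw [← CStarRing.norm_star_mul_self, star_mul, hfs]
      have h2 : cfc f (star a * a) * star a * (a * cfc f (star a * a)) =
          cfc (fun t => f t * t * f t) (star a * a) := by
        rw [cfc_mul (fun t => f t * t) f (star a * a)
            (hf := (hf.mul continuous_id).continuousOn) (hg := hf.continuousOn),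
          cfc_mul f (fun t => t) (star a * a) (hf := hf.continuousOn), cfc_id' ℝ (star a * a)]
        simp only [mul_assoc]
      rw [h2]
      refine norm_cfc_le (by positivity) ?_
      intro t _
      have h5 : |t| ≤ (max r (Real.sqrt |t|)) ^ 2 := by
        calc |t| = (Real.sqrt |t|) ^ 2 := (Real.sq_sqrt (abs_nonneg t)).symm
          _ ≤ _ := by gcongr; exact le_max_right _ _
      have h6 : ‖f t * t * f t‖ = r * r * (|t| / (max r (Real.sqrt |t|)) ^ 2) := by
        simp only [f, Real.norm_eq_abs, abs_mul, abs_div, abs_of_pos hrpos, abs_of_pos (hmax t)]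
        ring
      rw [h6]
      have h7 : |t| / (max r (Real.sqrt |t|)) ^ 2 ≤ 1 :=
        div_le_one_of_le₀ h5 (by positivity)
      nlinarith [mul_pos hrpos hrpos]
    nlinarith [norm_nonneg (a * cfc f (star a * a))]

lemma isClosed_range (π : A →⋆ₐ[ℂ] B) : IsClosed (Set.range π) := by
  let f : NormedAddGroupHom A B :=
    { toFun := π
      map_add' := map_add π
      bound' := ⟨1, fun v => by
        rw [one_mul]; exact NonUnitalStarAlgHom.norm_apply_le π v⟩ }
  have h : f.SurjectiveOnWith f.range 1 := by
    rintro _ ⟨a, rfl⟩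
    obtain ⟨a', h1, h2⟩ := exists_lift_norm_le π a
    exact ⟨a', h1, by rw [one_mul]; exact h2⟩
  have h2 := controlled_closure_of_complete one_pos one_pos h
  apply isClosed_of_closure_subset
  intro y hy
  have hy' : y ∈ f.range.topologicalClosure := by
    change y ∈ closure (Set.range π) at hy
    change y ∈ closure (f.range : Set B)
    exact hy
  obtain ⟨g, hg, -⟩ := h2 y hy'
  exact ⟨g, hg⟩

/-- The exponential unitary of a self-adjoint `q`, acting on eigenvectors from the left. -/
lemma exists_refl (q : A) (hq : IsSelfAdjoint q) : ∃ r : unitary A, Joined 1 r ∧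
    (∀ y, q * y = y → (r : A) * y = -y) ∧ (∀ y, q * y = 0 → (r : A) * y = y) := by
  let x : selfAdjoint A := ⟨(Real.pi : ℝ) • q, (IsSelfAdjoint.all Real.pi).smul hq⟩
  let _ : NormedAlgebra ℚ A := NormedAlgebra.restrictScalars ℚ ℂ A
  refine ⟨selfAdjoint.expUnitary x, selfAdjoint.joined_one_expUnitary x, ?_, ?_⟩
  · intro y hy
    have h : SemiconjBy y (algebraMap ℂ A (Complex.I * Real.pi)) (Complex.I • (x : A)) := by
      simp only [SemiconjBy, x, smul_mul_assoc, hy]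
      rw [← Algebra.commutes, ← Algebra.smul_def, mul_smul]
      rfl
    have h2 := h.exp_right
    have h3 : NormedSpace.exp (algebraMap ℂ A (Complex.I * Real.pi)) = -1 := by
      rw [← NormedSpace.algebraMap_exp_comm, ← Complex.exp_eq_exp_ℂ, mul_comm, Complex.exp_pi_mul_I]
      simp
    rw [h3, SemiconjBy] at h2
    rw [selfAdjoint.expUnitary_coe, ← h2]
    simp
  · intro y hy
    have h : SemiconjBy y 0 (Complex.I • (x : A)) := by
      simp [SemiconjBy, x, hy]
    have h2 := h.exp_right
    rw [NormedSpace.exp_zero, SemiconjBy] at h2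
    rw [selfAdjoint.expUnitary_coe, ← h2]
    simp

/-- The unitary shifting `w 0 * d, …, w n * d`. -/
lemma exists_shift (w : ℕ → A) (d : A) (n : ℕ)
    (h1 : ∀ i ≤ n, star (w i) * (w i * d) = d)
    (h0 : ∀ i ≤ n, ∀ j ≤ n, i ≠ j → star (w i) * w j = 0) :
    ∃ u : unitary A, Joined 1 u ∧ (∀ i < n, (u : A) * (w i * d) = w (i + 1) * d) := by
  have key : ∀ k ≤ n, ∃ u : unitary A, Joined 1 u ∧
      (∀ i < k, (u : A) * (w i * d) = w (i + 1) * d) ∧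
      (∀ i ≤ n, k < i → (u : A) * (w i * d) = w i * d) := by
    intro k
    induction k with
    | zero => exact fun _ => ⟨1, Joined.refl 1, by simp, by simp⟩
    | succ k ih =>
      intro hk
      obtain ⟨u, hu, hu1, hu2⟩ := ih (by omega)
      have hkn : k ≤ n := by omega
      have hz : ∀ i ≤ n, ∀ j ≤ n, i ≠ j → star (w i) * (w j * d) = 0 := by
        intro i hi j hj hij
        rw [← mul_assoc, h0 i hi j hj hij, zero_mul]
      let v := w k - w (k + 1)
      have hq : IsSelfAdjoint ((1 / 2 : ℝ) • (v * star v)) :=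
        (IsSelfAdjoint.all (1 / 2 : ℝ)).smul (IsSelfAdjoint.mul_star_self v)
      obtain ⟨r, hr, hr1, hr2⟩ := exists_refl _ hq
      have e1 : star v * (w k * d) = d := by
        simp only [v, star_sub, sub_mul, h1 k hkn, hz (k+1) hk k hkn (by omega), sub_zero]
      have e2 : star v * (w (k + 1) * d) = -d := by
        simp only [v, star_sub, sub_mul, h1 (k+1) hk, hz k hkn (k+1) hk (by omega), zero_sub]
      have e3 : ∀ i ≤ n, i ≠ k → i ≠ k + 1 → (r : A) * (w i * d) = w i * d := by
        intro i hi hik hik'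
        apply hr2
        rw [smul_mul_assoc, mul_assoc]
        have : star v * (w i * d) = 0 := by
          simp only [v, star_sub, sub_mul, hz (k+1) hk i hi (Ne.symm hik'),
            hz k hkn i hi (Ne.symm hik), sub_zero]
        rw [this]; simp
      have e4 := hr1 (w k * d - w (k + 1) * d) (by
        rw [smul_mul_assoc, mul_assoc, mul_sub, e1, e2, sub_neg_eq_add, ← two_smul ℝ d,
          mul_smul_comm, smul_smul]
        norm_num [v, sub_mul])
      have e5 := hr2 (w k * d + w (k + 1) * d) (by
        rw [smul_mul_assoc, mul_assoc, mul_add, e1, e2]; simp)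
      have e6 : (r : A) * (w k * d) = w (k + 1) * d := by
        rw [mul_sub] at e4
        rw [mul_add] at e5
        have : (2 : ℝ) • ((r : A) * (w k * d)) = (2 : ℝ) • (w (k + 1) * d) := by
          rw [two_smul, two_smul]
          have := congrArg₂ (· + ·) e4 e5
          calc _ = (r : A) * (w k * d) - r * (w (k + 1) * d) + (r * (w k * d) + r * (w (k + 1) * d)) := by abel
            _ = _ := by rw [this]; abel
        exact smul_right_injective A (two_ne_zero) this
      refine ⟨u * r, by simpa using hu.mul hr, ?_, ?_⟩
      · intro i hi
        rw [Submonoid.coe_mul, mul_assoc]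
        rcases Nat.lt_succ_iff_lt_or_eq.mp hi with hi | rfl
        · rw [e3 i (by omega) (by omega) (by omega), hu1 i hi]
        · rw [e6, hu2 _ hk (by omega)]
      · intro i hi hki
        rw [Submonoid.coe_mul, mul_assoc, e3 i hi (by omega) (by omega), hu2 i hi (by omega)]
  obtain ⟨u, a, b, -⟩ := key n le_rfl
  exact ⟨u, a, b⟩

/-- Cutting a self-adjoint `c = z* z`. -/
lemma exists_cut (π : A →⋆ₐ[ℂ] B) (z : A) (hz : π z ≠ 0) : ∃ s e x : A,
    IsSelfAdjoint e ∧ IsSelfAdjoint s ∧ π e ≠ 0 ∧ e = star z * z * x ∧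
    s * (star z * z) * s * e = e ∧ star z * z * (s * s) * e = e ∧
    star (star z * z * (s * s)) = star z * z * (s * s) := by
  set c := star z * z with hc
  have hsa : IsSelfAdjoint c := IsSelfAdjoint.star_mul_self z
  have hpc : π c = star (π z) * π z := by rw [hc, map_mul, map_star]
  have hsa' : IsSelfAdjoint (π c) := hsa.map π
  obtain ⟨N, hN, hNpos⟩ : ∃ N ∈ spectrum ℝ (π c), 0 < N := by
    by_contra! hcon
    have h0 : π c = 0 := by
      rw [← cfc_id' ℝ (π c), ← cfc_zero ℝ (π c)]
      apply cfc_congr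
      intro t ht
      refine le_antisymm (hcon t ht) ?_
      rw [hpc] at ht
      exact spectrum_star_mul_self_nonneg t ht
    rw [hpc, CStarRing.star_mul_self_eq_zero_iff] at h0
    exact hz h0
  let m : ℝ → ℝ := fun t => max t (N / 2)
  have hmpos : ∀ t, 0 < m t := fun t => lt_max_of_lt_right (by positivity)
  have hm : Continuous m := by fun_prop
  let φ : ℝ → ℝ := fun t => max (t - N / 2) 0
  have hφ : Continuous φ := by fun_prop
  let ψ : ℝ → ℝ := fun t => (Real.sqrt (m t))⁻¹
  have hψ : Continuous ψ :=
    (Real.continuous_sqrt.comp hm).inv₀ (fun t => (Real.sqrt_pos.mpr (hmpos t)).ne')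
  let χ : ℝ → ℝ := fun t => φ t / m t
  have hχ : Continuous χ := hφ.div hm (fun t => (hmpos t).ne')
  have hψ2 : ∀ t, ψ t * ψ t = (m t)⁻¹ := by
    intro t
    simp only [ψ]
    rw [← mul_inv, Real.mul_self_sqrt (hmpos t).le]
  have key : ∀ t, t * (m t)⁻¹ * φ t = φ t := by
    intro t
    by_cases ht : t ≤ N / 2
    · have : φ t = 0 := max_eq_right (by linarith)
      rw [this, mul_zero]
    · have h1 : m t = t := max_eq_left (by linarith)
      rw [h1, mul_inv_cancel₀ (by linarith), one_mul]
  have hid : Continuous (fun t : ℝ => t) := continuous_id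
  have hss : IsSelfAdjoint (cfc ψ c) := cfc_predicate ψ c
  have hcs : Commute c (cfc ψ c) := by
    have := cfc_commute_cfc (fun t : ℝ => t) ψ c
    rwa [cfc_id' ℝ c] at this
  have E1 : c * (cfc ψ c * cfc ψ c) = cfc (fun t => t * (ψ t * ψ t)) c := by
    rw [cfc_mul (fun t => t) (fun t => ψ t * ψ t) c (hf := hid.continuousOn)
      (hg := (hψ.mul hψ).continuousOn), cfc_id' ℝ c,
      cfc_mul ψ ψ c (hf := hψ.continuousOn) (hg := hψ.continuousOn)]
  have E2 : c * (cfc ψ c * cfc ψ c) * cfc φ c = cfc φ c := by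
    rw [E1, ← cfc_mul (fun t => t * (ψ t * ψ t)) φ c
      (hf := (hid.mul (hψ.mul hψ)).continuousOn) (hg := hφ.continuousOn)]
    congr 1
    funext t
    rw [hψ2, key]
  refine ⟨cfc ψ c, cfc φ c, cfc χ c, cfc_predicate φ c, hss, ?_, ?_, ?_, E2, ?_⟩
  · rw [map_cfc_real π φ hφ hsa]
    intro h0
    have h1 : cfc φ (π c) = cfc (fun _ => (0 : ℝ)) (π c) := by
      rw [h0, cfc_const_zero ℝ (π c)]
    have h2 := (cfc_eq_cfc_iff_eqOn (R := ℝ) (a := π c) (hf := hφ.continuousOn)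
      (hg := continuousOn_const)).mp h1 hN
    have h3 : φ N = N / 2 := by
      simp only [φ]; rw [max_eq_left (by linarith)]; ring
    simp only [h3] at h2
    linarith
  · have : cfc φ c = cfc (fun t => t * χ t) c := by
      congr 1
      funext t
      rw [← key t]
      simp only [χ]
      rw [key t]
      nth_rewrite 1 [← key t]
      ring
    rw [this, cfc_mul (fun t => t) χ c (hf := hid.continuousOn) (hg := hχ.continuousOn),
      cfc_id' ℝ c]
  · rw [← hcs.eq, mul_assoc c, E2]
  · rw [E1]
    exact (cfc_predicate (fun t => t * (ψ t * ψ t)) c : IsSelfAdjoint _)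

end General

section Rep

variable {A H : Type} [CStarAlgebra A] [NormedAddCommGroup H]
    [InnerProductSpace ℂ H] [CompleteSpace H] {π : A →⋆ₐ[ℂ] (H →L[ℂ] H)}

lemma dense_orbit (hπ : IsIrreducibleRep π) {v : H} (hv : v ≠ 0) :
    Dense (Set.range fun a : A => π a v) := by
  let L : A →ₗ[ℂ] H :=
    { toFun := fun a => π a v
      map_add' := fun a b => by simp
      map_smul' := fun c a => by simp }
  have hcl : IsClosed ((LinearMap.range L).topologicalClosure : Set H) :=
    Submodule.isClosed_topologicalClosure _
  have h := hπ (LinearMap.range L).topologicalClosure hcl (by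
    intro a x hx
    have hmaps : Set.MapsTo (π a) (LinearMap.range L : Set H) (LinearMap.range L : Set H) := by
      rintro _ ⟨b, rfl⟩
      exact ⟨a * b, by simp [L]⟩
    exact hmaps.closure (π a).continuous hx)
  rcases h with h | h
  · exfalso
    have : v ∈ (LinearMap.range L).topologicalClosure :=
      Submodule.le_topologicalClosure _ ⟨1, by simp [L]⟩
    rw [h] at this
    exact hv ((Submodule.mem_bot ℂ).mp this)
  · rw [dense_iff_closure_eq]
    have := congrArg (fun S : Submodule ℂ H => (S : Set H)) h
    simp only [Submodule.topologicalClosure_coe, Submodule.top_coe] at this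
    exact this

lemma prime_rep (hπ : IsIrreducibleRep π) {x y : A} (hx : π x ≠ 0) (hy : π y ≠ 0) :
    ∃ z, π (x * z * y) ≠ 0 := by
  by_contra! hcon
  obtain ⟨v, hv⟩ : ∃ v, π y v ≠ 0 := by
    by_contra! h
    exact hy (ContinuousLinearMap.ext h)
  apply hx
  have : (π x : H → H) = fun _ => 0 := by
    refine Continuous.ext_on (dense_orbit hπ hv) (π x).continuous continuous_const ?_
    rintro _ ⟨z, rfl⟩
    have := congrArg (fun T : H →L[ℂ] H => T v) (hcon z)
    simpa using this
  exact ContinuousLinearMap.ext fun v => congrFun this v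

open InnerProductSpace in
lemma compact_mem_range (hπ : IsIrreducibleRep π) (b : A) (hb : IsSelfAdjoint b) (hb0 : π b ≠ 0)
    (ζ : H) (hζ : ∀ v, ∃ k : ℂ, π b v = k • ζ) (K : H →L[ℂ] H) (hK : IsCompactOperator K) :
    K ∈ Set.range π := by
  have hcl := isClosed_range π
  obtain ⟨v, hv⟩ : ∃ v, π b v ≠ 0 := by
    by_contra! h
    exact hb0 (ContinuousLinearMap.ext h)
  have hζ0 : ζ ≠ 0 := by
    rintro rfl
    obtain ⟨k, hk⟩ := hζ v
    exact hv (by simpa using hk)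
  have hinn : inner ℂ ζ ζ ≠ 0 := inner_self_ne_zero.mpr hζ0
  have hsym : ∀ x y, inner ℂ (π b x) y = inner ℂ x (π b y) := by
    intro x y
    have h : ContinuousLinearMap.adjoint (π b) = π b := by
      have := hb.map π
      exact this
    nth_rewrite 2 [← h]
    rw [ContinuousLinearMap.adjoint_inner_right]
  obtain ⟨k, hk⟩ := hζ ζ
  -- `π b` is a multiple of a rank one operator
  have hform : ∀ x, π b x = (k / inner ℂ ζ ζ) • rankOne ℂ ζ ζ x := by
    intro x
    obtain ⟨l, hl⟩ := hζ x
    have h1 := hsym ζ x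
    have h2 := hsym ζ ζ
    rw [hk, hl, inner_smul_left, inner_smul_right] at h1
    rw [hk, inner_smul_left, inner_smul_right] at h2
    have h3 := mul_right_cancel₀ hinn h2
    rw [h3] at h1
    rw [hl, rankOne_apply, smul_smul]
    congr 1
    field_simp
    exact h1.symm
  have hk0 : k / inner ℂ ζ ζ ≠ 0 := by
    intro h
    apply hv
    rw [hform, h, zero_smul]
  have hr0 : rankOne ℂ ζ ζ ∈ Set.range π := by
    refine ⟨(k / inner ℂ ζ ζ)⁻¹ • b, ?_⟩
    ext x
    rw [map_smul, smul_apply, hform, smul_smul, inv_mul_cancel₀ hk0, one_smul]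
  obtain ⟨r, hr⟩ := hr0
  have hr1 : ∀ x y : A, rankOne ℂ (π x ζ) (π y ζ) ∈ Set.range π := by
    intro x y
    refine ⟨x * r * star y, ?_⟩
    ext v
    rw [map_mul, map_mul, hr, map_star]
    simp only [mul_apply_eq_comp, rankOne_apply, map_smul]
    rw [ContinuousLinearMap.star_eq_adjoint, ContinuousLinearMap.adjoint_inner_right]
  have hd := dense_orbit hπ hζ0
  have hr2 : ∀ (x : A) (y : H), rankOne ℂ (π x ζ) y ∈ Set.range π := by
    intro x y
    have hc : IsClosed {y : H | rankOne ℂ (π x ζ) y ∈ Set.range π} :=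
      hcl.preimage (rankOne ℂ (π x ζ)).continuous
    have : y ∈ closure (Set.range fun a : A => π a ζ) := hd y
    refine (closure_minimal ?_ hc) this
    rintro _ ⟨a, rfl⟩
    exact hr1 x a
  have hr3 : ∀ x y : H, rankOne ℂ x y ∈ Set.range π := by
    intro x y
    have hc : IsClosed {x : H | rankOne ℂ x y ∈ Set.range π} :=
      hcl.preimage (show Continuous fun x : H => rankOne ℂ x y by fun_prop)
    have : x ∈ closure (Set.range fun a : A => π a ζ) := hd x
    refine (closure_minimal ?_ hc) this
    rintro _ ⟨a, rfl⟩
    exact hr2 a y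
  -- approximate `K`
  rw [← hcl.closure_eq, Metric.mem_closure_iff]
  intro ε hε
  have hcomp := hK.isCompact_closure_image_closedBall (1 : ℝ)
  have htb := (hcomp.totallyBounded).subset subset_closure
  obtain ⟨t, htfin, ht⟩ := Metric.totallyBounded_iff.mp htb (ε / 2) (by positivity)
  let S : Submodule ℂ H := Submodule.span ℂ t
  have : FiniteDimensional ℂ S := FiniteDimensional.span_of_finite ℂ htfin
  let o := stdOrthonormalBasis ℂ S
  refine ⟨S.starProjection * K, ?_, ?_⟩
  · have : S.starProjection * K =
        ∑ i, rankOne ℂ (o i : H) (ContinuousLinearMap.adjoint K (o i : H)) := by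
      ext v
      rw [o.starProjection_eq_sum_rankOne, mul_apply_eq_comp, sum_apply, sum_apply]
      simp [rankOne_apply, ContinuousLinearMap.adjoint_inner_left]
    rw [this]
    have hmem : ∀ i, ∃ a, π a = rankOne ℂ (o i : H) (ContinuousLinearMap.adjoint K (o i : H)) :=
      fun i => hr3 _ _
    choose a ha using hmem
    exact ⟨∑ i, a i, by rw [map_sum]; exact Finset.sum_congr rfl fun i _ => ha i⟩
  · rw [dist_eq_norm]
    refine lt_of_le_of_lt (b := ε / 2) ?_ (by linarith)
    refine ContinuousLinearMap.opNorm_le_of_unit_norm (𝕜 := ℂ) (by positivity) ?_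
    intro v hv
    have hmem : K v ∈ K '' Metric.closedBall 0 1 := ⟨v, by simp [hv], rfl⟩
    obtain ⟨y, hy, hy2⟩ := Set.mem_iUnion₂.mp (ht hmem)
    have hyS : y ∈ S := Submodule.subset_span hy
    have : ‖K v - S.starProjection (K v)‖ ≤ ‖K v - y‖ := by
      rw [Submodule.starProjection_minimal]
      exact ciInf_le ⟨0, by rintro _ ⟨x, rfl⟩; exact norm_nonneg _⟩ (⟨y, hyS⟩ : S)
    simp only [sub_apply, mul_apply_eq_comp]
    rw [Metric.mem_ball, dist_eq_norm] at hy2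
    exact this.trans hy2.le

lemma split_spec {B : Type} [CStarAlgebra B] (ρ : A →⋆ₐ[ℂ] B) (c : A) (hc : IsSelfAdjoint c)
    (hno : ¬ ∃ c₁ c₂ x₁ x₂ : A, IsSelfAdjoint c₁ ∧ IsSelfAdjoint c₂ ∧ ρ c₁ ≠ 0 ∧ ρ c₂ ≠ 0 ∧
      c₁ * c₂ = 0 ∧ c₁ = c * x₁ ∧ c₂ = c * x₂) :
    ∃ μ : ℝ, ρ c * ρ c = μ • ρ c := by
  have hc' : IsSelfAdjoint (ρ c) := hc.map ρ
  by_cases h0 : ∀ l ∈ spectrum ℝ (ρ c), l = 0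
  · refine ⟨0, ?_⟩
    have : ρ c = 0 := by
      rw [← cfc_id' ℝ (ρ c), ← cfc_zero ℝ (ρ c)]
      exact cfc_congr fun t ht => h0 t ht
    simp [this]
  push Not at h0
  obtain ⟨l, hl, hl0⟩ := h0
  have hall : ∀ m ∈ spectrum ℝ (ρ c), m = 0 ∨ m = l := by
    intro m hm
    by_contra! hcon
    obtain ⟨hm0, hml⟩ := hcon
    apply hno
    let δ := |m - l| / 2
    have hδ : 0 < δ := by
      have : 0 < |m - l| := abs_pos.mpr (sub_ne_zero.mpr hml)
      simp only [δ]; positivity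
    let f : ℝ → ℝ → ℝ := fun p t => max (δ - |t - p|) 0
    have hf : ∀ p, Continuous (f p) := fun p => by fun_prop
    have hid : Continuous (fun t : ℝ => t) := continuous_id
    have hg : ∀ p, Continuous (fun t => t * f p t) := fun p => hid.mul (hf p)
    have hne : ∀ p ∈ spectrum ℝ (ρ c), p ≠ 0 → ρ (cfc (fun t => t * f p t) c) ≠ 0 := by
      intro p hp hp0
      rw [map_cfc_real ρ _ (hg p) hc]
      intro h
      have h1 : cfc (fun t => t * f p t) (ρ c) = cfc (fun _ => (0 : ℝ)) (ρ c) := by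
        rw [h, cfc_const_zero ℝ (ρ c)]
      have h2 := (cfc_eq_cfc_iff_eqOn (R := ℝ) (a := ρ c) (hf := (hg p).continuousOn)
        (hg := continuousOn_const)).mp h1 hp
      have h3 : f p p = δ := by
        simp only [f, sub_self, abs_zero, sub_zero]; exact max_eq_left hδ.le
      simp only [h3] at h2
      exact (mul_ne_zero hp0 hδ.ne') h2
    have hfac : ∀ p, cfc (fun t => t * f p t) c = c * cfc (f p) c := by
      intro p
      rw [cfc_mul (fun t => t) (f p) c (hf := hid.continuousOn) (hg := (hf p).continuousOn),
        cfc_id' ℝ c]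
    refine ⟨cfc (fun t => t * f l t) c, cfc (fun t => t * f m t) c, cfc (f l) c, cfc (f m) c,
      cfc_predicate _ c, cfc_predicate _ c, hne l hl hl0, hne m hm hm0, ?_, hfac l, hfac m⟩
    rw [← cfc_mul _ _ c (hf := (hg l).continuousOn) (hg := (hg m).continuousOn),
      ← cfc_const_zero ℝ c]
    congr 1
    funext t
    have : f l t * f m t = 0 := by
      by_cases h : |t - l| < δ
      · have h2 : δ ≤ |t - m| := by
          have h3 : |m - l| ≤ |t - m| + |t - l| := by
            calc |m - l| = |(t - l) - (t - m)| := by ring_nf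
              _ ≤ |t - l| + |t - m| := abs_sub _ _
              _ = _ := add_comm _ _
          have h4 : |m - l| = 2 * δ := by simp only [δ]; ring
          linarith
        have : f m t = 0 := max_eq_right (by linarith)
        rw [this, mul_zero]
      · have : f l t = 0 := max_eq_right (by linarith)
        rw [this, zero_mul]
    calc _ = t * t * (f l t * f m t) := by ring
      _ = 0 := by rw [this, mul_zero]
  refine ⟨l, ?_⟩
  have hid : ContinuousOn (fun t : ℝ => t) (spectrum ℝ (ρ c)) := continuousOn_id
  have h1 : ρ c * ρ c = cfc (fun t : ℝ => t * t) (ρ c) := by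
    rw [cfc_mul (fun t : ℝ => t) (fun t => t) (ρ c) (hf := hid) (hg := hid), cfc_id' ℝ (ρ c)]
  have h2 : l • ρ c = cfc (fun t : ℝ => l * t) (ρ c) := by
    rw [cfc_const_mul l (fun t : ℝ => t) (ρ c) (hf := hid), cfc_id' ℝ (ρ c)]
  rw [h1, h2]
  apply cfc_congr
  intro t ht
  rcases hall t ht with h | h <;> simp [h]

lemma split (hπ : IsIrreducibleRep π) (K : H →L[ℂ] H) (hK : IsCompactOperator K)
    (hKr : K ∉ Set.range π) (b : A) (hb : IsSelfAdjoint b) (hb0 : π b ≠ 0) :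
    ∃ c₁ c₂ x₁ x₂ : A, IsSelfAdjoint c₁ ∧ IsSelfAdjoint c₂ ∧ π c₁ ≠ 0 ∧ π c₂ ≠ 0 ∧
      c₁ * c₂ = 0 ∧ c₁ = b * x₁ ∧ c₂ = b * x₂ := by
  by_contra hno
  apply hKr
  have step1 : ∀ x : A, IsSelfAdjoint x → ∃ μ : ℝ,
      π (b * x * b) * π (b * x * b) = μ • π (b * x * b) := by
    intro x hx
    have hc : IsSelfAdjoint (b * x * b) := by
      have := hx.conjugate b
      rwa [hb.star_eq] at this
    refine split_spec π _ hc ?_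
    rintro ⟨c₁, c₂, x₁, x₂, h1, h2, h3, h4, h5, h6, h7⟩
    exact hno ⟨c₁, c₂, x * b * x₁, x * b * x₂, h1, h2, h3, h4, h5, by rw [h6]; simp only [mul_assoc],
      by rw [h7]; simp only [mul_assoc]⟩
  set B := π b with hB
  have hBs : star B = B := hb.map π
  obtain ⟨l, hl⟩ := step1 1 (IsSelfAdjoint.one A)
  simp only [mul_one, map_mul, ← hB] at hl
  have hT0 : B * B ≠ 0 := by
    intro h
    rw [← hBs] at h
    nth_rewrite 2 [hBs] at h
    exact hb0 ((CStarRing.star_mul_self_eq_zero_iff B).mp h)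
  have hl0 : l ≠ 0 := by
    rintro rfl
    rw [zero_smul] at hl
    have hs : star (B * B) = B * B := by rw [star_mul, hBs]
    have := (CStarRing.star_mul_self_eq_zero_iff (B * B)).mp (by rw [hs]; exact hl)
    exact hT0 this
  have hB3 : B * B * B = l • B := by
    have hs : star (B * B * B - l • B) = B * B * B - l • B := by
      simp only [star_sub, star_mul, hBs, star_smul, star_trivial, mul_assoc]
    have h1 : (B * B * B - l • B) * B = 0 := by
      rw [sub_mul, smul_mul_assoc, mul_assoc, hl, sub_self]
    have h2 : B * B * B - l • B = B * (B * B - l • 1) := by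
      rw [mul_sub, mul_smul_comm, mul_one, mul_assoc]
    rw [← sub_eq_zero, ← CStarRing.star_mul_self_eq_zero_iff, hs]
    nth_rewrite 2 [h2]
    rw [← mul_assoc, h1, zero_mul]
  have step3 : ∀ x : A, IsSelfAdjoint x → ∃ k : ℝ, π (b * x * b) = k • (B * B) := by
    intro x hx
    set T := π (b * x * b) with hT
    have hTe : T = B * π x * B := by rw [hT, map_mul, map_mul]
    obtain ⟨μ, hμ⟩ := step1 x hx
    rw [← hT] at hμ
    have c1 : T * (B * B) = l • T := by
      rw [hTe]
      calc B * π x * B * (B * B) = B * π x * (B * B * B) := by simp only [mul_assoc]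
        _ = _ := by rw [hB3, mul_smul_comm]
    have c2 : (B * B) * T = l • T := by
      rw [hTe]
      calc B * B * (B * π x * B) = (B * B * B) * (π x * B) := by simp only [mul_assoc]
        _ = _ := by rw [hB3, smul_mul_assoc, mul_assoc]
    have c3 : ∀ t : ℝ, ∃ ν : ℝ, (μ + 2 * t * l - ν) • T = (ν * t - t * t * l) • (B * B) := by
      intro t
      obtain ⟨ν, hν⟩ := step1 (x + t • 1) (hx.add ((IsSelfAdjoint.all t).smul (IsSelfAdjoint.one A)))
      have he : π (b * (x + t • 1) * b) = T + t • (B * B) := by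
        have : b * (x + t • 1) * b = b * x * b + ((t : ℂ) • (b * b)) := by
          rw [mul_add, add_mul, mul_smul_comm, mul_one, smul_mul_assoc]; rfl
        rw [this, map_add, map_smul, map_mul π b b]; rfl
      rw [he] at hν
      refine ⟨ν, ?_⟩
      have hexp : (T + t • (B * B)) * (T + t • (B * B)) =
          μ • T + (2 * t * l) • T + (t * t * l) • (B * B) := by
        rw [add_mul, mul_add, mul_add, smul_mul_assoc, smul_mul_assoc, mul_smul_comm,
          mul_smul_comm, hμ, c1, c2, hl]
        module
      rw [hexp] at hν
      rw [← sub_eq_zero] at hν ⊢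
      rw [← hν]
      module
    obtain ⟨ν1, h1⟩ := c3 1
    obtain ⟨ν2, h2⟩ := c3 2
    have solve : ∀ p q : ℝ, p ≠ 0 → p • T = q • (B * B) → ∃ k : ℝ, T = k • (B * B) := by
      intro p q hp h
      refine ⟨p⁻¹ * q, ?_⟩
      rw [mul_smul, ← h, smul_smul, inv_mul_cancel₀ hp, one_smul]
    by_cases e1 : μ + 2 * 1 * l - ν1 = 0
    · by_cases e2 : μ + 2 * 2 * l - ν2 = 0
      · exfalso
        rw [e1, zero_smul] at h1
        rw [e2, zero_smul] at h2
        have g1 := (smul_eq_zero.mp h1.symm).resolve_right hT0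
        have g2 := (smul_eq_zero.mp h2.symm).resolve_right hT0
        apply hl0
        linarith
      · exact solve _ _ e2 h2
    · exact solve _ _ e1 h1
  have step4 : ∀ a : A, ∃ k : ℂ, π (b * a * b) = k • (B * B) := by
    intro a
    obtain ⟨k1, h1⟩ := step3 (realPart a : A) (realPart a).2
    obtain ⟨k2, h2⟩ := step3 (imaginaryPart a : A) (imaginaryPart a).2
    refine ⟨(k1 : ℂ) + Complex.I * k2, ?_⟩
    have e : b * a * b = b * (realPart a : A) * b + Complex.I • (b * (imaginaryPart a : A) * b) := by
      conv_lhs => rw [← realPart_add_I_smul_imaginaryPart a]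
      rw [mul_add, add_mul, mul_smul_comm, smul_mul_assoc]
    rw [e, map_add, map_smul, h1, h2, add_smul, mul_smul]
    rfl
  obtain ⟨η, hη⟩ : ∃ v, B v ≠ 0 := by
    by_contra! h
    exact hb0 (ContinuousLinearMap.ext h)
  refine compact_mem_range hπ b hb hb0 ((B * B) η) ?_ K hK
  intro v
  have hcl : IsClosed {v : H | B v ∈ (Submodule.span ℂ {(B * B) η} : Submodule ℂ H)} :=
    (Submodule.closed_of_finiteDimensional _).preimage B.continuous
  have hmem : v ∈ closure (Set.range fun a : A => π a (B η)) := dense_orbit hπ hη v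
  have := closure_minimal (t := {v : H | B v ∈ (Submodule.span ℂ {(B * B) η} : Submodule ℂ H)}) (by
    rintro _ ⟨a, rfl⟩
    obtain ⟨k, hk⟩ := step4 a
    refine Submodule.mem_span_singleton.mpr ⟨k, ?_⟩
    have := congrArg (fun T : H →L[ℂ] H => T η) hk
    rw [map_mul, map_mul] at this
    exact this.symm) hcl hmem
  obtain ⟨k, hk⟩ := Submodule.mem_span_singleton.mp this
  exact ⟨k, hk.symm⟩

lemma chain (hπ : IsIrreducibleRep π) (K : H →L[ℂ] H) (hK : IsCompactOperator K)
    (hKr : K ∉ Set.range π) (n : ℕ) : ∀ b : A, IsSelfAdjoint b → π b ≠ 0 →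
    ∃ (w : ℕ → A) (d : A), d ≠ 0 ∧ w 0 * d = d ∧ (∃ x, d = b * x) ∧
      (∀ i ≤ n, ∃ x, w i = b * x) ∧
      (∀ i ≤ n, star (w i) * (w i * d) = d) ∧
      (∀ i ≤ n, ∀ j ≤ n, i ≠ j → star (w i) * w j = 0) := by
  induction n with
  | zero =>
    intro b hb hb0
    obtain ⟨s, e, x, he, hs, he0, hex, h1, h2, h3⟩ := exists_cut π b hb0
    refine ⟨fun _ => star b * b * (s * s), e, ?_, h2, ?_, ?_, ?_, ?_⟩
    · rintro rfl; exact he0 (map_zero π)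
    · exact ⟨b * x, by rw [hex, hb.star_eq, mul_assoc]⟩
    · intro i _
      exact ⟨b * (s * s), by rw [hb.star_eq, mul_assoc]⟩
    · intro i _
      simp only [h3, h2]
    · intro i hi j hj hij
      omega
  | succ n ih =>
    intro b hb hb0
    obtain ⟨c₁, c₂, x₁, x₂, hc₁, hc₂, h1, h2, h12, hx₁, hx₂⟩ := split hπ K hK hKr b hb hb0
    obtain ⟨y, hy⟩ := prime_rep hπ h1 h2
    obtain ⟨s, e, x, he, hs, he0, hex, hk1, -, -⟩ := exists_cut π (c₁ * y * c₂) hy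
    obtain ⟨w, d, hd, hwd, ⟨xd, hxd⟩, hw, hw1, hw0⟩ := ih e he he0
    obtain ⟨e', he'⟩ : ∃ e', e = c₂ * e' := by
      refine ⟨star (c₁ * y) * (c₁ * y * c₂) * x, ?_⟩
      rw [hex, star_mul, hc₂.star_eq]
      simp only [mul_assoc]
    have hnew : ∀ i ≤ n, star (c₁ * y * c₂ * s) * w i = 0 := by
      intro i hi
      obtain ⟨z, hz⟩ := hw i hi
      rw [hz, he']
      simp only [star_mul, hc₁.star_eq, mul_assoc]
      rw [← mul_assoc c₁ c₂, h12]
      simp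
    refine ⟨Function.update w (n + 1) (c₁ * y * c₂ * s), d, hd, ?_, ?_, ?_, ?_, ?_⟩
    · rw [Function.update_of_ne (by omega)]; exact hwd
    · exact ⟨x₂ * e' * xd, by rw [hxd, he', hx₂]; simp only [mul_assoc]⟩
    · intro i hi
      rcases Nat.le_succ_iff.mp hi with hi | rfl
      · rw [Function.update_of_ne (by omega)]
        obtain ⟨z, hz⟩ := hw i hi
        exact ⟨x₂ * e' * z, by rw [hz, he', hx₂]; simp only [mul_assoc]⟩
      · rw [Function.update_self]
        exact ⟨x₁ * y * c₂ * s, by rw [hx₁]; simp only [mul_assoc]⟩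
    · intro i hi
      rcases Nat.le_succ_iff.mp hi with hi | rfl
      · rw [Function.update_of_ne (by omega)]
        exact hw1 i hi
      · rw [Function.update_self, star_mul, hs.star_eq, hxd]
        calc s * star (c₁ * y * c₂) * (c₁ * y * c₂ * s * (e * xd))
            = (s * (star (c₁ * y * c₂) * (c₁ * y * c₂)) * s * e) * xd := by
              simp only [mul_assoc]
          _ = e * xd := by rw [hk1]
    · intro i hi j hj hij
      rcases Nat.le_succ_iff.mp hi with hi | rfl
      · rw [Function.update_of_ne (by omega : i ≠ n + 1)]
        rcases Nat.le_succ_iff.mp hj with hj | rfl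
        · rw [Function.update_of_ne (by omega)]
          exact hw0 i hi j hj hij
        · rw [Function.update_self]
          have := congrArg star (hnew i hi)
          rwa [star_mul, star_star, star_zero] at this
      · rw [Function.update_self]
        rcases Nat.le_succ_iff.mp hj with hj | rfl
        · rw [Function.update_of_ne (by omega)]
          exact hnew j hj
        · exact absurd rfl hij

end Rep

end OrthConj

/-- Lemma 2.2: if `A` is unital and not of type I, then for every `n` there are a unitary
`u` homotopic to `1` in the unitary group and a nonzero positive `a` such that
`a, u a u⁻¹, …, uⁿ a u⁻ⁿ` are pairwise orthogonal. -/
theorem exists_unitary_orthogonal_conjugates (A : Type) [CStarAlgebra A]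
    [PartialOrder A] [StarOrderedRing A]
    (htype : ¬ IsTypeI A) (n : ℕ) (hn : 0 < n) :
    ∃ u : unitary A, Joined (1 : unitary A) u ∧
      ∃ a : A, 0 ≤ a ∧ a ≠ 0 ∧
        ∀ i j : ℕ, i ≤ n → j ≤ n → i ≠ j →
          ((u : A) ^ i * a * star ((u : A) ^ i)) *
            ((u : A) ^ j * a * star ((u : A) ^ j)) = 0 := by
  unfold IsTypeI at htype
  push Not at htype
  obtain ⟨H, _, _, _, π, hπ, K, hK, hKr⟩ := htype
  have h1 : π (1 : A) ≠ 0 := by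
    intro h
    apply hKr
    refine ⟨0, ?_⟩
    rw [map_zero, ← mul_one K, ← map_one π, h, mul_zero]
  obtain ⟨w, d, hd, hwd, -, -, hw1, hw0⟩ :=
    OrthConj.chain hπ K hK hKr n 1 (IsSelfAdjoint.one A) h1
  obtain ⟨u, hu, hu1⟩ := OrthConj.exists_shift w d n hw1 hw0
  refine ⟨u, hu, d * star d, mul_star_self_nonneg d, ?_, ?_⟩
  · intro h
    exact hd ((CStarRing.mul_star_self_eq_zero_iff d).mp h)
  · have hpow : ∀ i ≤ n, (u : A) ^ i * d = w i * d := by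
      intro i
      induction i with
      | zero => intro _; rw [pow_zero, one_mul, hwd]
      | succ i ih =>
        intro hi
        rw [pow_succ', mul_assoc, ih (by omega), hu1 i (by omega)]
    intro i j hi hj hij
    have e : ∀ k ≤ n, (u : A) ^ k * (d * star d) * star ((u : A) ^ k) =
        w k * d * (star d * star (w k)) := by
      intro k hk
      calc (u : A) ^ k * (d * star d) * star ((u : A) ^ k)
          = ((u : A) ^ k * d) * star ((u : A) ^ k * d) := by
            rw [star_mul]; simp only [mul_assoc]
        _ = _ := by rw [hpow k hk, star_mul]
    rw [e i hi, e j hj]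
    calc w i * d * (star d * star (w i)) * (w j * d * (star d * star (w j)))
        = w i * d * star d * (star (w i) * w j) * (d * (star d * star (w j))) := by
          simp only [mul_assoc]
      _ = 0 := by rw [hw0 i hi j hj hij]; simp
end

section
/- Let A be a stably finite simple unital C*-algebra and let a be a positive element of K ⊗ A. Then the Cuntz class ⟨a⟩ is the class of a projection if and only if 0 is an isolated point of the spectrum of a. -/
open Filter Topology

/-- Cuntz equivalence: mutual Cuntz subequivalence. -/
def CuntzEquiv (A : Type*) [Mul A] [Star A] [TopologicalSpace A] (a b : A) : Prop :=
  CuntzSubequiv A a b ∧ CuntzSubequiv A b a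

/-- A projection is a self-adjoint idempotent. -/
def IsProjection {A : Type*} [Mul A] [Star A] (p : A) : Prop :=
  star p = p ∧ p * p = p

/-- An infinite projection: one Murray–von Neumann equivalent to a proper
subprojection of itself. -/
def IsInfiniteProjection {A : Type*} [Mul A] [Star A] (p : A) : Prop :=
  IsProjection p ∧
    ∃ v : A, star v * v = p ∧ p * (v * star v) = v * star v ∧ v * star v ≠ p

/-- The upper-left corner embedding `Mₙ(A) → Mₙ₊₁(A)`. -/
def cornerEmbed {A : Type*} [Zero A] (n : ℕ) (x : Matrix (Fin n) (Fin n) A) :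
    Matrix (Fin (n + 1)) (Fin (n + 1)) A :=
  Matrix.of fun i j => if h : (i : ℕ) < n ∧ (j : ℕ) < n then x ⟨i, h.1⟩ ⟨j, h.2⟩ else 0

theorem ded_of_isom {M : Type*} [CStarAlgebra M]
    (h : ∀ v : M, star v * v = 1 → v * star v = 1) (x y : M) (hxy : x * y = 1) : y * x = 1 := by
  let _ := CStarAlgebra.spectralOrder M
  have := CStarAlgebra.spectralOrderedRing M
  have h1 : (1 : M) ≤ ‖star x * x‖ • (star y * y) := by
    have := CStarAlgebra.star_left_conjugate_le_norm_smul (a := y) (b := star x * x)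
    calc (1 : M) = star (x * y) * (x * y) := by simp [hxy]
      _ = star y * (star x * x) * y := by simp [mul_assoc]
      _ ≤ _ := this
  have hu : IsUnit (‖star x * x‖ • (star y * y)) :=
    CStarAlgebra.isUnit_of_le 1 h1
  have hu2 : IsUnit (star y * y) := by
    rcases eq_or_ne ‖star x * x‖ 0 with h0 | h0
    · rw [h0, zero_smul] at hu
      have : Subsingleton M := isUnit_zero_iff.1 hu |> subsingleton_of_zero_eq_one
      exact isUnit_of_subsingleton _
    · have := hu.smul (Units.mk0 _ h0)⁻¹
      simpa [Units.smul_def, smul_smul, h0] using this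
  have hu3 : IsUnit (CFC.sqrt (star y * y)) := (CFC.isUnit_sqrt_iff _ (star_mul_self_nonneg y)).2 hu2
  obtain ⟨s, hs⟩ := hu3
  have hss : (s : M) * s = star y * y := by
    rw [hs]; exact CFC.sqrt_mul_sqrt_self _ (star_mul_self_nonneg y)
  have hsa : star (s : M) = s := by
    rw [hs]; exact (CFC.sqrt_nonneg _).isSelfAdjoint
  have hsa' : star ((s⁻¹ : Mˣ) : M) = (s⁻¹ : Mˣ) := by
    rw [← Units.coe_star, ← Units.ext_iff, star_inv]
    congr 1
    exact Units.ext hsa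
  have h2 := h (y * (s⁻¹ : Mˣ)) (by
    rw [star_mul, hsa']
    calc _ = (s⁻¹ : Mˣ) * (star y * y) * ((s⁻¹ : Mˣ) : M) := by simp [mul_assoc]
      _ = 1 := by rw [← hss]; simp )
  rw [star_mul, hsa', mul_assoc] at h2
  have := left_inv_eq_right_inv hxy h2
  rw [this]; exact h2

theorem ded_unitization {B : Type*} [NonUnitalCStarAlgebra B] {M : ℕ → Type*}
    [∀ n, CStarAlgebra (M n)] (e : ∀ n, M n →⋆ₙₐ[ℂ] B) (hinj : ∀ n, Function.Injective (e n))
    (hM : ∀ n (x y : M n), x * y = 1 → y * x = 1)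
    (hmono : Monotone fun n => Set.range (e n))
    (hdense : Dense (⋃ n, Set.range (e n)))
    (u v : Unitization ℂ B) (huv : u * v = 1) : v * u = 1 := by
  have key : ∀ (b : B) (v : Unitization ℂ B), (1 + (b : Unitization ℂ B)) * v = 1 →
      v * (1 + (b : Unitization ℂ B)) = 1 := by
    intro b v hv
    have hfst : v.fst = 1 := by simpa using congrArg (fun t : Unitization ℂ B => t.fst) hv
    obtain ⟨c, rfl⟩ : ∃ c : B, v = 1 + (c : Unitization ℂ B) :=
      ⟨v.snd, by ext <;> simp [hfst]⟩
    have hc1 : Continuous fun q : B × B =>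
        ‖(1 + (q.1 : Unitization ℂ B)) * (1 + (q.2 : Unitization ℂ B)) - 1‖ := by
      have := (Unitization.isometry_inr (𝕜 := ℂ) (A := B)).continuous
      fun_prop
    have hc2 : Continuous fun q : B × B =>
        ‖(1 + (q.1 : Unitization ℂ B)) * (1 + (c : Unitization ℂ B)) - 1‖ := by
      have := (Unitization.isometry_inr (𝕜 := ℂ) (A := B)).continuous
      fun_prop
    have ho := (isOpen_lt hc1 continuous_const (g := fun _ => (1 : ℝ))).inter
      (isOpen_lt hc2 continuous_const (g := fun _ => (1 : ℝ)))
    obtain ⟨⟨b', c'⟩, ⟨h1, h2⟩, hb', hc'⟩ := (hdense.prod hdense).inter_open_nonempty _ ho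
      ⟨(b, c), by simp [hv], by simp [hv]⟩
    simp only [Set.mem_ofPred_eq] at h1 h2
    obtain ⟨n₁, hn₁⟩ := Set.mem_iUnion.1 hb'
    obtain ⟨n₂, hn₂⟩ := Set.mem_iUnion.1 hc'
    obtain ⟨x, hx⟩ := hmono (le_max_left n₁ n₂) hn₁
    obtain ⟨y, hy⟩ := hmono (le_max_right n₁ n₂) hn₂
    generalize max n₁ n₂ = n at x y hx hy
    simp only at hx hy
    subst hx hy
    have h3 : ‖(1 + x) * (1 + y) - 1‖ < 1 := by
      rw [← NonUnitalStarAlgHom.norm_map (e n) (hinj n), ← Unitization.norm_inr (𝕜 := ℂ)]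
      refine lt_of_eq_of_lt (congrArg norm ?_) h1
      have : (1 + x) * (1 + y) - 1 = x + y + x * y := by noncomm_ring
      rw [this]
      simp only [map_add, map_mul, Unitization.inr_add, Unitization.inr_mul]
      noncomm_ring
    have hu : IsUnit ((1 + x) * (1 + y)) := by
      have := (Units.oneSub (1 - (1 + x) * (1 + y)) (by rwa [norm_sub_rev])).isUnit
      simpa using this
    obtain ⟨r, hr⟩ := hu.exists_right_inv
    rw [mul_assoc] at hr
    have hr' := hM n _ _ hr
    set g := (1 + y) * r with hg
    have e1 : g - 1 + x + x * (g - 1) = 0 := by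
      have : g - 1 + x + x * (g - 1) = (1 + x) * g - 1 := by noncomm_ring
      rw [this, hr, sub_self]
    have e2 : g - 1 + x + (g - 1) * x = 0 := by
      have : g - 1 + x + (g - 1) * x = g * (1 + x) - 1 := by noncomm_ring
      rw [this, hr', sub_self]
    have hU : IsUnit (1 + ((e n x : B) : Unitization ℂ B)) := by
      refine ⟨⟨_, 1 + ((e n (g - 1) : B) : Unitization ℂ B), ?_, ?_⟩, rfl⟩
      · have := congrArg (fun t => ((e n t : B) : Unitization ℂ B)) e1
        simp only [map_add, map_mul, Unitization.inr_add, Unitization.inr_mul, map_zero,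
          Unitization.inr_zero] at this
        rw [← sub_eq_zero, ← this, map_sub, Unitization.inr_sub]
        noncomm_ring
      · have := congrArg (fun t => ((e n t : B) : Unitization ℂ B)) e2
        simp only [map_add, map_mul, Unitization.inr_add, Unitization.inr_mul, map_zero,
          Unitization.inr_zero] at this
        rw [← sub_eq_zero, ← this, map_sub, Unitization.inr_sub]
        noncomm_ring
    have hUv : IsUnit ((1 + ((e n x : B) : Unitization ℂ B)) * (1 + (c : Unitization ℂ B))) := by
      have := (Units.oneSub (1 - (1 + ((e n x : B) : Unitization ℂ B)) * (1 + (c : Unitization ℂ B)))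
        (by rwa [norm_sub_rev])).isUnit
      simpa using this
    obtain ⟨U, hU⟩ := hU
    rw [← hU, Units.isUnit_units_mul] at hUv
    obtain ⟨V, hV⟩ := hUv
    rw [← hV] at hv ⊢
    rw [left_inv_eq_right_inv hv V.mul_inv, V.mul_inv]
  have hfst : u.fst * v.fst = 1 := by simpa using congrArg (fun t : Unitization ℂ B => t.fst) huv
  have hne : u.fst ≠ 0 := left_ne_zero_of_mul_eq_one hfst
  have := key (u.fst⁻¹ • u.snd) (u.fst • v) (by
    have : (1 + ((u.fst⁻¹ • u.snd : B) : Unitization ℂ B)) = u.fst⁻¹ • u := by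
      ext <;> simp [hne]
    rw [this, smul_mul_smul_comm, huv, inv_mul_cancel₀ hne, one_smul])
  have h2 : (1 + ((u.fst⁻¹ • u.snd : B) : Unitization ℂ B)) = u.fst⁻¹ • u := by
      ext <;> simp [hne]
  rwa [h2, smul_mul_smul_comm, mul_inv_cancel₀ hne, one_smul] at this

theorem cfc_pieces {R : Type*} [CStarAlgebra R] (a : R) (ha : IsSelfAdjoint a)
    (hpos : ∀ t ∈ spectrum ℝ a, 0 ≤ t) (ε t₀ : ℝ) (hε0 : 0 < ε) (ht₀ : t₀ ∈ spectrum ℝ a)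
    (ht₀pos : 0 < t₀) (hlt : t₀ < ε) :
    ∃ b' k ψ : R, b' * (ψ * a * ψ) = b' ∧ k * (ψ * a * ψ) = k ∧ b' * k = 0 ∧ k * b' = 0 ∧
      ‖a - b' * b'‖ ≤ ε ∧ star k = k ∧ k ≠ 0 := by
  obtain ⟨F, hF⟩ : ∃ F : ℝ → ℝ, F = fun t : ℝ => √(max (t - ε) 0) := ⟨_, rfl⟩
  obtain ⟨G, hG⟩ : ∃ G : ℝ → ℝ, G = fun t : ℝ => max (min (t - t₀ / 2) (ε - t)) 0 := ⟨_, rfl⟩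
  obtain ⟨Ψ, hΨ⟩ : ∃ Ψ : ℝ → ℝ, Ψ = fun t : ℝ => (√(max t (t₀ / 2)))⁻¹ := ⟨_, rfl⟩
  have cF : ContinuousOn F (spectrum ℝ a) := by rw [hF]; exact Continuous.continuousOn (by fun_prop)
  have cG : ContinuousOn G (spectrum ℝ a) := by rw [hG]; exact Continuous.continuousOn (by fun_prop)
  have cΨ : ContinuousOn Ψ (spectrum ℝ a) := by
    rw [hΨ]
    refine (Continuous.inv₀ (by fun_prop) fun t => ?_).continuousOn
    have : 0 < max t (t₀ / 2) := lt_max_of_lt_right (by positivity)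
    positivity
  have cI : ContinuousOn (fun t : ℝ => t) (spectrum ℝ a) := continuousOn_id
  have cΨ1 : ContinuousOn (fun t => Ψ t * t) (spectrum ℝ a) := cΨ.mul cI
  have cΨ2 : ContinuousOn (fun t => Ψ t * t * Ψ t) (spectrum ℝ a) := cΨ1.mul cΨ
  have hψ2 : ∀ t : ℝ, t₀ / 2 ≤ t → Ψ t * t * Ψ t = 1 := by
    intro t ht
    simp only [hΨ]
    rw [max_eq_left ht]
    have htp : 0 < t := by linarith
    have : √t ≠ 0 := by positivity
    field_simp
    rw [Real.sq_sqrt htp.le]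
  have hF0 : ∀ t, t ≤ ε → F t = 0 := fun t ht => by
    simp only [hF]; rw [max_eq_right (by linarith : t - ε ≤ 0)]; simp
  have hG0 : ∀ t, t ≤ t₀ / 2 → G t = 0 := fun t ht => by
    simp only [hG]; exact max_eq_right ((min_le_left _ _).trans (by linarith))
  have hG1 : ∀ t, ε ≤ t → G t = 0 := fun t ht => by
    simp only [hG]; exact max_eq_right ((min_le_right _ _).trans (by linarith))
  have hφ : cfc Ψ a * a * cfc Ψ a = cfc (fun t : ℝ => Ψ t * t * Ψ t) a := by
    rw [cfc_mul (fun t => Ψ t * t) Ψ a cΨ1 cΨ, cfc_mul Ψ (fun t => t) a cΨ cI, cfc_id' ℝ a ha]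
  have hbk : cfc F a * cfc G a = 0 := by
    rw [← cfc_mul F G a cF cG, ← cfc_zero ℝ a]
    refine cfc_congr fun t ht => ?_
    beta_reduce
    rcases le_total ε t with h | h
    · rw [hG1 t h]; simp
    · rw [hF0 t h]; simp
  refine ⟨cfc F a, cfc G a, cfc Ψ a, ?_, ?_, hbk, ?_, ?_, cfc_predicate (R := ℝ) _ a, ?_⟩
  · rw [hφ, ← cfc_mul F _ a cF cΨ2]
    refine cfc_congr fun t ht => ?_
    beta_reduce
    rcases le_total (t₀ / 2) t with h | h
    · rw [hψ2 t h, mul_one]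
    · rw [hF0 t (by linarith), zero_mul]
  · rw [hφ, ← cfc_mul G _ a cG cΨ2]
    refine cfc_congr fun t ht => ?_
    beta_reduce
    rcases le_total (t₀ / 2) t with h | h
    · rw [hψ2 t h, mul_one]
    · rw [hG0 t h, zero_mul]
  · rw [← hbk]; exact cfc_commute_cfc _ _ a
  · have : a - cfc F a * cfc F a = cfc (fun t => t - F t * F t) a := by
      rw [cfc_sub (fun t => t) (fun t => F t * F t) a cI (cF.mul cF), cfc_mul F F a cF cF,
        cfc_id' ℝ a ha]
    rw [this]
    refine norm_cfc_le hε0.le fun t ht => ?_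
    simp only [hF]
    rw [Real.mul_self_sqrt (le_max_right _ _), Real.norm_eq_abs, abs_le]
    have := hpos t ht
    rcases le_total ε t with h | h
    · rw [max_eq_left (by linarith)]; constructor <;> linarith
    · rw [max_eq_right (by linarith)]; constructor <;> linarith
  · intro h0
    have hle := norm_apply_le_norm_cfc G a ht₀ cG ha
    rw [h0, norm_zero, hG] at hle
    have : 0 < min (t₀ - t₀ / 2) (ε - t₀) := lt_min (by linarith) (by linarith)
    have h5 := (le_abs_self _).trans hle
    exact absurd (lt_of_lt_of_le this (le_max_left _ 0)) (not_lt.2 h5)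

theorem main_R {R : Type*} [CStarAlgebra R] (hD : ∀ x y : R, x * y = 1 → y * x = 1)
    (a p : R) (ha : IsSelfAdjoint a) (hpos : ∀ t ∈ spectrum ℝ a, 0 ≤ t) (hp : p * p = p)
    (w z : ℕ → R) (hw : Tendsto (fun n => w n * a * star (w n)) atTop (𝓝 p))
    (hz : Tendsto (fun n => z n * p * star (z n)) atTop (𝓝 a)) :
    ∃ ε > 0, ∀ t ∈ spectrum ℝ a, t < ε → t = 0 := by
  -- choose w
  obtain ⟨w, hw⟩ : ∃ w : R, ‖p * (w * a * star w) * p - p‖ < 1 := by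
    have h1 : Tendsto (fun n => ‖p * (w n * a * star (w n)) * p - p‖) atTop (𝓝 0) := by
      have := (((hw.const_mul p).mul_const p).sub_const p).norm
      simpa [hp] using this
    obtain ⟨n, hn⟩ := (h1.eventually_lt_const one_pos).exists
    exact ⟨_, hn⟩
  set C := ‖p * w‖ * ‖star w * p‖ with hC
  have hC0 : 0 ≤ C := by positivity
  set δ := 1 - ‖p * (w * a * star w) * p - p‖ with hδ
  have hδ0 : 0 < δ := by linarith
  set ε := δ / (C + 1) with hε
  have hε0 : 0 < ε := by positivity
  refine ⟨ε, hε0, fun t₀ ht₀ hlt => ?_⟩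
  by_contra hne
  have ht₀pos : 0 < t₀ := lt_of_le_of_ne (hpos _ ht₀) (Ne.symm hne)
  obtain ⟨b', k, ψ, hbφ, hkφ, hbk, hkb, hbb, hksa, hkne⟩ :=
    cfc_pieces a ha hpos ε t₀ hε0 ht₀ ht₀pos hlt
  -- X Y = p
  have hu : ‖p * w * (b' * b') * (star w * p) - p‖ < 1 := by
    have h1 : p * w * (b' * b') * (star w * p) - p =
        (p * (w * a * star w) * p - p) - (p * w) * (a - b' * b') * (star w * p) := by noncomm_ring
    have h2 : ‖(p * w) * (a - b' * b') * (star w * p)‖ ≤ C * ε := by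
      calc _ ≤ ‖p * w‖ * ‖a - b' * b'‖ * ‖star w * p‖ :=
            (norm_mul_le _ _).trans (by gcongr; exact norm_mul_le _ _)
        _ ≤ ‖p * w‖ * ε * ‖star w * p‖ := by gcongr
        _ = C * ε := by rw [hC]; ring
    have h3 : C * ε < δ := by
      rw [hε, ← mul_div_assoc, div_lt_iff₀ (by positivity)]; nlinarith
    rw [h1]
    calc _ ≤ _ := norm_sub_le _ _
      _ < 1 := by linarith
  have hunit : IsUnit (p * w * (b' * b') * (star w * p) + (1 - p)) := by
    have := (Units.oneSub (-(p * w * (b' * b') * (star w * p) - p)) (by rwa [norm_neg])).isUnit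
    convert this using 1
    simp only [Units.val_oneSub]; noncomm_ring
  obtain ⟨D, hDD⟩ := hunit.exists_right_inv
  set X := p * w * b' with hX
  set Y := b' * (star w * p * D) with hY
  have hXY : X * Y = p := by
    have := congrArg (p * ·) hDD
    simp only [mul_one] at this
    rw [← this, hX, hY]
    have h0 : p * (1 - p) = 0 := by rw [mul_sub, hp]; simp
    have : p * ((p * w * (b' * b') * (star w * p) + (1 - p)) * D) =
      (p * p) * w * (b' * b') * (star w * p) * D + p * (1 - p) * D := by noncomm_ring
    rw [this, h0, hp]; noncomm_ring
  have hXφ : X * (ψ * a * ψ) = X := by rw [hX, mul_assoc, hbφ]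
  have hXk : X * k = 0 := by rw [hX, mul_assoc, hbk, mul_zero]
  have hkY : k * Y = 0 := by rw [hY, ← mul_assoc, hkb, zero_mul]
  have L : ∀ c d : R, Tendsto (fun n => c * ψ * (z n * p * star (z n)) * ψ * d) atTop
      (𝓝 (c * (ψ * a * ψ) * d)) := by
    intro c d
    have := ((hz.const_mul (c * ψ)).mul_const ψ).mul_const d
    convert this using 2
    simp only [mul_assoc]
  set S : ℕ → R := fun n => X * ψ * z n * p with hS
  set T : ℕ → R := fun n => p * star (z n) * ψ * Y with hT
  have hSp : ∀ n, S n * p = S n := fun n => by simp only [hS]; rw [mul_assoc, hp]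
  have hpT : ∀ n, p * T n = T n := fun n => by simp only [hT, ← mul_assoc, hp]
  have hST : Tendsto (fun n => S n * T n) atTop (𝓝 p) := by
    have := L X Y
    rw [hXφ, hXY] at this
    convert this using 2 with n
    simp only [hS, hT]
    calc _ = X * ψ * z n * (p * p) * star (z n) * ψ * Y := by simp only [mul_assoc]
      _ = _ := by rw [hp]; simp only [mul_assoc]
  set W : ℕ → R := fun n => (S n + (1 - p)) * (T n + (1 - p)) with hW
  have hWeq : ∀ n, W n = S n * T n + (1 - p) := by
    intro n
    have h1 : S n * (1 - p) = 0 := by rw [mul_sub, hSp]; simp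
    have h2 : (1 - p) * T n = 0 := by rw [sub_mul, hpT]; simp
    have h3 : (1 - p) * (1 - p) = 1 - p := by
      have : (1 - p) * (1 - p) = 1 - p - p + p * p := by noncomm_ring
      rw [this, hp]; abel
    simp only [hW]
    rw [add_mul, mul_add, mul_add, h1, h2, h3]; abel
  have hW1 : Tendsto W atTop (𝓝 1) := by
    have := hST.add_const (1 - p)
    rw [add_sub_cancel] at this
    exact this.congr fun n => (hWeq n).symm
  have hWinv : Tendsto (fun n => Ring.inverse (W n)) atTop (𝓝 1) := by
    have := (NormedRing.inverse_continuousAt (1 : Rˣ)).tendsto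
    simp only [Units.val_one, Ring.inverse_one] at this
    exact this.comp hW1
  have hWu : ∀ᶠ n in atTop, IsUnit (W n) :=
    hW1.eventually (Units.isOpen.mem_nhds isUnit_one)
  have hpTS : ∀ᶠ n in atTop, p = T n * Ring.inverse (W n) * S n := by
    filter_upwards [hWu] with n hn
    have h1 : (S n + (1 - p)) * ((T n + (1 - p)) * Ring.inverse (W n)) = 1 := by
      rw [← mul_assoc]; exact Ring.mul_inverse_cancel _ hn
    have h2 := hD _ _ h1
    have h3 : p * (T n + (1 - p)) = T n := by
      rw [mul_add, hpT, mul_sub, hp]; simp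
    have h4 : (S n + (1 - p)) * p = S n := by
      rw [add_mul, hSp, sub_mul, hp]; simp
    calc p = p * 1 * p := by rw [mul_one, hp]
      _ = p * ((T n + (1 - p)) * Ring.inverse (W n) * (S n + (1 - p))) * p := by rw [h2]
      _ = (p * (T n + (1 - p))) * Ring.inverse (W n) * ((S n + (1 - p)) * p) := by
        simp only [mul_assoc]
      _ = _ := by rw [h3, h4]
  have hlim0 : Tendsto (fun n => k * ψ * (z n * p * star (z n)) * ψ * k) atTop (𝓝 0) := by
    have := ((L k Y).mul hWinv).mul (L X k)
    rw [hkφ, hkY, zero_mul, zero_mul] at this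
    refine this.congr' ?_
    filter_upwards [hpTS] with n hn
    symm
    calc k * ψ * (z n * p * star (z n)) * ψ * k
        = k * ψ * (z n * (T n * Ring.inverse (W n) * S n) * star (z n)) * ψ * k := by rw [← hn]
      _ = _ := by simp only [hS, hT, mul_assoc]
  have hkk : k * k = 0 := by
    have := tendsto_nhds_unique (L k k) hlim0
    rwa [hkφ] at this
  exact hkne (by rw [← CStarRing.star_mul_self_eq_zero_iff, hksa, hkk])

theorem isolated_iff {B : Type*} [NonUnitalCStarAlgebra B] [PartialOrder B] [StarOrderedRing B]
    (a : B) (ha : 0 ≤ a) : 𝓝[(quasispectrum ℂ a) \ {0}] (0 : ℂ) = ⊥ ↔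
      ∃ ε > 0, ∀ t ∈ quasispectrum ℝ a, t < ε → t = 0 := by
  have himg := (IsSelfAdjoint.of_nonneg ha).quasispectrumRestricts.algebraMap_image
  rw [← not_iff_not, ← ne_eq, ← Filter.neBot_iff, ← mem_closure_iff_nhdsWithin_neBot,
    Metric.mem_closure_iff, ← himg]
  push Not
  refine forall₂_congr fun ε hε => ?_
  constructor
  · rintro ⟨_, ⟨⟨t, ht, rfl⟩, h0⟩, hd⟩
    refine ⟨t, ht, ?_, fun h => h0 (by simp [h])⟩
    have : |t| < ε := by simpa using hd
    exact (le_abs_self t).trans_lt this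
  · rintro ⟨t, ht, hlt, hne⟩
    refine ⟨_, ⟨⟨t, ht, rfl⟩, by simpa using hne⟩, ?_⟩
    have := quasispectrum_nonneg_of_nonneg a ha t ht
    simpa [abs_of_nonneg this] using hlt

theorem exists_proj {B : Type*} [NonUnitalCStarAlgebra B] [PartialOrder B] [StarOrderedRing B]
    (a : B) (ha : 0 ≤ a) (ε : ℝ) (hε : 0 < ε) (h : ∀ t ∈ quasispectrum ℝ a, t < ε → t = 0) :
    ∃ p : B, IsProjection p ∧ CuntzEquiv B a p := by
  have hsa := IsSelfAdjoint.of_nonneg ha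
  have hpos := quasispectrum_nonneg_of_nonneg (𝕜 := ℝ) a ha
  obtain ⟨F, hF⟩ : ∃ F : ℝ → ℝ, F = fun t : ℝ => min 1 (t / ε) := ⟨_, rfl⟩
  obtain ⟨G, hG⟩ : ∃ G : ℝ → ℝ, G = fun t : ℝ => min 1 (t / ε) * (√(max t ε))⁻¹ := ⟨_, rfl⟩
  have cF : ContinuousOn F (quasispectrum ℝ a) := by
    rw [hF]; exact Continuous.continuousOn (by fun_prop)
  have cG : ContinuousOn G (quasispectrum ℝ a) := by
    rw [hG]
    refine (Continuous.mul (by fun_prop) (Continuous.inv₀ (by fun_prop) fun t => ?_)).continuousOn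
    have : 0 < max t ε := lt_max_of_lt_right hε
    positivity
  have cH : ContinuousOn (fun t => √t) (quasispectrum ℝ a) :=
    Continuous.continuousOn (by fun_prop)
  have cI : ContinuousOn (fun t : ℝ => t) (quasispectrum ℝ a) := continuousOn_id
  have F0 : F 0 = 0 := by simp [hF]
  have G0 : G 0 = 0 := by simp [hG]
  have F1 : ∀ t, ε ≤ t → F t = 1 := fun t ht => by
    simp only [hF]; exact min_eq_left ((one_le_div hε).2 ht)
  have G1 : ∀ t, ε ≤ t → G t * t * G t = 1 := fun t ht => by
    have hF1 := F1 t ht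
    simp only [hF] at hF1
    simp only [hG]
    rw [hF1, max_eq_left ht]
    have htp : 0 < t := by linarith
    have : √t ≠ 0 := by positivity
    field_simp
    rw [Real.sq_sqrt htp.le]
  have cases_t : ∀ t ∈ quasispectrum ℝ a, t = 0 ∨ ε ≤ t := fun t ht =>
    (lt_or_ge t ε).imp (h t ht) id
  have hidem : cfcₙ F a * cfcₙ F a = cfcₙ F a := by
    rw [← cfcₙ_mul F F a cF F0 cF F0]
    refine cfcₙ_congr fun t ht => ?_
    beta_reduce
    rcases cases_t t ht with rfl | h1
    · rw [F0, mul_zero]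
    · rw [F1 t h1, mul_one]
  have hGsa : star (cfcₙ G a) = cfcₙ G a := (cfcₙ_predicate (R := ℝ) G a : IsSelfAdjoint _)
  have hHsa : star (cfcₙ (fun t : ℝ => √t) a) = cfcₙ (fun t : ℝ => √t) a :=
    (cfcₙ_predicate (R := ℝ) _ a : IsSelfAdjoint _)
  refine ⟨cfcₙ F a, ⟨(cfcₙ_predicate (R := ℝ) F a : IsSelfAdjoint _), hidem⟩,
    ⟨fun _ => cfcₙ (fun t : ℝ => √t) a, ?_⟩, ⟨fun _ => cfcₙ G a, ?_⟩⟩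
  · beta_reduce; rw [hHsa]
    have : cfcₙ (fun t : ℝ => √t) a * cfcₙ F a * cfcₙ (fun t : ℝ => √t) a = a := by
      rw [← cfcₙ_mul (fun t => √t) F a cH (by simp) cF F0,
        ← cfcₙ_mul (fun t => √t * F t) (fun t => √t) a (cH.mul cF) (by simp) cH (by simp)]
      conv_rhs => rw [← cfcₙ_id' ℝ a hsa]
      refine cfcₙ_congr fun t ht => ?_
      beta_reduce
      rcases cases_t t ht with rfl | h1
      · simp
      · rw [F1 t h1, mul_one, Real.mul_self_sqrt (by linarith)]
    rw [this]; exact tendsto_const_nhds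
  · beta_reduce; rw [hGsa]
    have : cfcₙ G a * a * cfcₙ G a = cfcₙ F a := by
      have h2 : cfcₙ G a * a = cfcₙ (fun t => G t * t) a := by
        rw [cfcₙ_mul G (fun t => t) a cG G0 cI rfl, cfcₙ_id' ℝ a hsa]
      rw [h2, ← cfcₙ_mul (fun t => G t * t) G a (cG.mul cI) (by simp) cG G0]
      refine cfcₙ_congr fun t ht => ?_
      beta_reduce
      rcases cases_t t ht with rfl | h1
      · rw [F0, mul_zero, zero_mul]
      · rw [F1 t h1, G1 t h1]
    rw [this]; exact tendsto_const_nhds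

/-- Lemma 3.2: Let `A` be a stably finite simple unital C*-algebra and let `B` be
(a model of) `K ⊗ A`: a C*-algebra exhausted by an injective compatible chain of copies
of the matrix algebras `Mₙ(A)` with dense union.  Then a positive `a ∈ B` is Cuntz
equivalent to a projection if and only if `0` is an isolated point of the spectrum
of `a` (here the quasispectrum, which always contains `0`). -/
theorem cuntzEquiv_projection_iff_isolated_zero {A : Type*} [CStarAlgebra A]
    [PartialOrder A] [StarOrderedRing A]
    {B : Type*} [NonUnitalCStarAlgebra B] [PartialOrder B] [StarOrderedRing B]
    (hsimple : ∀ I : TwoSidedIdeal A, IsClosed (I : Set A) → I = ⊥ ∨ I = ⊤)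
    (hstablyfinite : ∀ (n : ℕ) (p : Matrix (Fin n) (Fin n) A), ¬ IsInfiniteProjection p)
    (e : ∀ n : ℕ, Matrix (Fin n) (Fin n) A →⋆ₙₐ[ℂ] B)
    (hinj : ∀ n, Function.Injective (e n))
    (hcompat : ∀ (n : ℕ) (x : Matrix (Fin n) (Fin n) A), e (n + 1) (cornerEmbed n x) = e n x)
    (hdense : Dense (⋃ n, Set.range (e n)))
    (a : B) (ha : 0 ≤ a) :
    (∃ p : B, IsProjection p ∧ CuntzEquiv B a p) ↔
      𝓝[(quasispectrum ℂ a) \ {0}] (0 : ℂ) = ⊥ := by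
  rw [isolated_iff a ha]
  constructor
  swap
  · rintro ⟨ε, hε, h⟩
    exact exists_proj a ha ε hε h
  rintro ⟨p, ⟨-, hpp⟩, ⟨z, hz⟩, ⟨w, hw⟩⟩
  have hD : ∀ u v : Unitization ℂ B, u * v = 1 → v * u = 1 := by
    refine ded_unitization (M := fun n => CStarMatrix (Fin n) (Fin n) A)
      (fun n => (e n).comp
        ((CStarMatrix.ofMatrixStarAlgEquiv (n := Fin n) (A := A)).symm :
          CStarMatrix (Fin n) (Fin n) A →⋆ₙₐ[ℂ] Matrix (Fin n) (Fin n) A))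
      (fun n => (hinj n).comp (CStarMatrix.ofMatrixStarAlgEquiv (n := Fin n) (A := A)).symm.injective)
      ?_ ?_ ?_
    · intro n x y hxy
      refine ded_of_isom (fun v hv => ?_) x y hxy
      by_contra hne
      refine hstablyfinite n (1 : Matrix (Fin n) (Fin n) A) ⟨⟨star_one _, one_mul _⟩, v, hv, one_mul _, hne⟩
    · refine monotone_nat_of_le_succ fun n => ?_
      rintro _ ⟨x, rfl⟩
      exact ⟨cornerEmbed n x, hcompat n x⟩
    · exact hdense
  have hcont := (Unitization.isometry_inr (𝕜 := ℂ) (A := B)).continuous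
  have hspec : quasispectrum ℝ a = spectrum ℝ (a : Unitization ℂ B) :=
    Unitization.quasispectrum_eq_spectrum_inr' ℝ ℂ a
  rw [hspec]
  refine main_R hD (a : Unitization ℂ B) (p : Unitization ℂ B) ?_ ?_ ?_
    (fun n => (w n : Unitization ℂ B)) (fun n => (z n : Unitization ℂ B)) ?_ ?_
  · exact (IsSelfAdjoint.of_nonneg ha).inr ℂ
  · rw [← hspec]; exact quasispectrum_nonneg_of_nonneg a ha
  · rw [← Unitization.inr_mul, hpp]
  · simpa [Function.comp_def] using (hcont.tendsto p).comp hw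
  · simpa [Function.comp_def] using (hcont.tendsto a).comp hz
end
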